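/- arXiv:1611.05985 — 3 statements merged into one kernel-verified Lean document; each statement's English description precedes it below -/
import Mathlib

section
/- Let x0 ∈ ℝⁿ be a k-sparse vector, let a_1, …, a_m be independent standard Gaussian random vectors in ℝⁿ (a_i ∼ N(0, I_{n×n})), and suppose the magnitudes |⟨a_i, x0⟩| for i = 1…m are observed. Let φ be a unit vector with ⟨φ, x0/‖x0‖₂⟩ =: α > 0. Let λ satisfy (1/2)·α/√k < λ < (3/4)·α/√k, and assume k < (1/49)·α²·n. Then there exist positive universal constants C₁, C₂, c such that if m > (C₁/α⁷)·k·log(n/k), then with probability at least 1 − C₂·exp(−c·α^{−2/5}·m^{4/5}·k^{1/5}), x0 is the unique maximizer of the linear program SparsePhaseMax: maximize ⟨φ, x⟩ − λ‖x‖₁ over x ∈ ℝⁿ subject to −|⟨a_i, x0⟩| ≤ ⟨a_i, x⟩ ≤ |⟨a_i, x0⟩| for all i = 1…m. -/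
open MeasureTheory ProbabilityTheory

/-- The ℓ² (Euclidean) norm on ℝⁿ. -/
noncomputable def l2norm {n : ℕ} (x : Fin n → ℝ) : ℝ := Real.sqrt (∑ j, (x j) ^ 2)

/-- The ℓ¹ norm on ℝⁿ. -/
noncomputable def l1norm {n : ℕ} (x : Fin n → ℝ) : ℝ := ∑ j, |x j|

/-- The Euclidean inner product on ℝⁿ. -/
noncomputable def dot {n : ℕ} (x y : Fin n → ℝ) : ℝ := ∑ j, x j * y j

/-- The joint law of `m` independent standard Gaussian random vectors in ℝⁿ:
each of the `m * n` coordinates is an independent standard normal. -/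
noncomputable def stdGaussianVectors (m n : ℕ) : Measure (Fin m → Fin n → ℝ) :=
  Measure.pi fun _ : Fin m => Measure.pi fun _ : Fin n => gaussianReal 0 1

/-- `x` is feasible for SparsePhaseMax with measurements `a` and data `|⟨a i, x0⟩|`. -/
def SPMFeasible {n m : ℕ} (a : Fin m → Fin n → ℝ) (x0 x : Fin n → ℝ) : Prop :=
  ∀ i, -|dot (a i) x0| ≤ dot (a i) x ∧ dot (a i) x ≤ |dot (a i) x0|

/-- `x0` is the unique maximizer of SparsePhaseMax with anchor `φ` and parameter `λ`. -/
def SPMUniqueMax {n m : ℕ} (a : Fin m → Fin n → ℝ) (x0 φ : Fin n → ℝ) (lam : ℝ) : Prop :=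
  ∀ x : Fin n → ℝ, SPMFeasible a x0 x → x ≠ x0 →
    dot φ x - lam * l1norm x < dot φ x0 - lam * l1norm x0


/-- Exponential Markov inequality for a sum of i.i.d. random variables. -/
lemma pi_real_le_sum_le {X : Type*} [MeasurableSpace X] (μ : Measure X) [IsProbabilityMeasure μ]
    (f : X → ℝ) (hf : Integrable (fun x => Real.exp (f x)) μ) (m : ℕ) (T : ℝ) :
    (Measure.pi fun _ : Fin m => μ).real {a | T ≤ ∑ i, f (a i)} ≤
      Real.exp (-T) * (∫ x, Real.exp (f x) ∂μ) ^ m := by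
  have hint : Integrable (fun a : Fin m → X => ∏ i, Real.exp (f (a i)))
      (Measure.pi fun _ : Fin m => μ) :=
    Integrable.fintype_prod (f := fun _ x => Real.exp (f x)) fun _ => hf
  have h := mul_meas_ge_le_integral_of_nonneg
    (ae_of_all _ fun a => Finset.prod_nonneg fun i _ => (Real.exp_pos _).le) hint (Real.exp T)
  rw [integral_fintype_prod_eq_pow (fun x => Real.exp (f x)), Fintype.card_fin] at h
  simp_rw [← Real.exp_sum, Real.exp_le_exp] at h
  rw [Real.exp_neg, inv_mul_eq_div, le_div_iff₀ (Real.exp_pos T), mul_comm]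
  exact h

lemma le_gaussianReal_Icc {a b : ℝ} (ha : 0 ≤ a) (hab : a ≤ b) (hb : b ≤ 2) :
    (b - a) / 20 ≤ (gaussianReal 0 1).real (Set.Icc a b) := by
  have hlow : ∀ x ∈ Set.Icc a b, (1 : ℝ) / 20 ≤ gaussianPDFReal 0 1 x := by
    intro x hx
    have hx2 : x ^ 2 ≤ 4 := by nlinarith [hx.1, hx.2]
    have h1 : √(2 * Real.pi) ≤ 2.55 := by
      rw [Real.sqrt_le_left (by norm_num)]; nlinarith [Real.pi_lt_d2]
    have h1' : 0 < √(2 * Real.pi) := by positivity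
    have h2 : Real.exp (-2) ≤ Real.exp (-x ^ 2 / 2) := Real.exp_le_exp.2 (by linarith)
    have h3 : (0.13 : ℝ) ≤ Real.exp (-2) := by
      have : Real.exp (-2) = (Real.exp 1 ^ 2)⁻¹ := by
        rw [Real.exp_neg, ← Real.exp_nat_mul]; norm_num
      rw [this, le_inv_comm₀ (by norm_num) (by positivity)]
      nlinarith [Real.exp_one_lt_d9, Real.exp_pos 1]
    simp only [gaussianPDFReal, NNReal.coe_one, mul_one, sub_zero]
    rw [inv_mul_eq_div, le_div_iff₀ h1']
    linarith
  have hint := integrable_gaussianPDFReal 0 1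
  have hval : (gaussianReal 0 1).real (Set.Icc a b) = ∫ x in Set.Icc a b, gaussianPDFReal 0 1 x := by
    rw [measureReal_def, gaussianReal_apply_eq_integral _ one_ne_zero, ENNReal.toReal_ofReal]
    exact integral_nonneg fun x => gaussianPDFReal_nonneg _ _ _
  rw [hval]
  calc (b - a) / 20 = ∫ _ in Set.Icc a b, (1 : ℝ) / 20 := by
        simp [Real.volume_real_Icc_of_le hab]; ring
    _ ≤ _ := setIntegral_mono_on (by simp) hint.integrableOn measurableSet_Icc hlow

lemma le_gaussianReal_Ici (v : NNReal) :
    (1 : ℝ) / 20 ≤ (gaussianReal 0 v).real {x | √(v : ℝ) ≤ x} := by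
  have hmap : gaussianReal 0 v = (gaussianReal 0 1).map (√(v : ℝ) * ·) := by
    rw [gaussianReal_map_const_mul]
    congr 1
    · simp
    · ext; simp
  have hs : MeasurableSet {x : ℝ | √(v : ℝ) ≤ x} := measurableSet_Ici
  rw [hmap, map_measureReal_apply (by fun_prop) hs]
  refine le_trans ?_ (measureReal_mono (s₁ := Set.Icc 1 2) ?_)
  · have := le_gaussianReal_Icc (a := 1) (b := 2) (by norm_num) (by norm_num) le_rfl
    linarith
  · intro x hx
    simpa using le_mul_of_one_le_right (Real.sqrt_nonneg (v : ℝ)) hx.1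

lemma exp_sq_div_four_gaussianPDFReal (x : ℝ) :
    gaussianPDFReal 0 1 x * Real.exp (x ^ 2 / 4) =
      (√(2 * Real.pi))⁻¹ * Real.exp (-(1 / 4) * x ^ 2) := by
  simp only [gaussianPDFReal, NNReal.coe_one, mul_one, sub_zero]
  rw [mul_assoc, ← Real.exp_add]
  ring_nf

lemma integrable_exp_sq_gaussianReal :
    Integrable (fun x => Real.exp (x ^ 2 / 4)) (gaussianReal 0 1) := by
  rw [gaussianReal_of_var_ne_zero _ one_ne_zero, gaussianPDF_def,
    integrable_withDensity_iff_integrable_smul' (by fun_prop) (by simp)]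
  simp only [ENNReal.toReal_ofReal (gaussianPDFReal_nonneg _ _ _), smul_eq_mul,
    exp_sq_div_four_gaussianPDFReal]
  exact (integrable_exp_neg_mul_sq (by norm_num)).const_mul _

lemma integral_exp_sq_gaussianReal :
    ∫ x, Real.exp (x ^ 2 / 4) ∂(gaussianReal 0 1) = √2 := by
  rw [integral_gaussianReal_eq_integral_smul one_ne_zero]
  simp only [smul_eq_mul, exp_sq_div_four_gaussianPDFReal]
  rw [integral_const_mul, integral_gaussian, ← Real.sqrt_inv, ← Real.sqrt_mul (by positivity)]
  congr 1
  field_simp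
  norm_num

/-- The law of a single standard Gaussian vector in `ℝⁿ`. -/
noncomputable abbrev stdGaussianVector (n : ℕ) : Measure (Fin n → ℝ) :=
  Measure.pi fun _ : Fin n => gaussianReal 0 1

lemma dot_eq_inner {n : ℕ} (x y : Fin n → ℝ) :
    dot x y = inner ℝ (WithLp.toLp 2 x) (WithLp.toLp 2 y) := by
  simp [dot, PiLp.inner_apply, mul_comm]

lemma l2norm_eq_norm {n : ℕ} (x : Fin n → ℝ) : l2norm x = ‖WithLp.toLp 2 x‖ := by
  simp [l2norm, EuclideanSpace.norm_eq]

lemma hasGaussianLaw_toLp (n : ℕ) :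
    HasGaussianLaw (WithLp.toLp 2 : (Fin n → ℝ) → EuclideanSpace ℝ (Fin n))
      (stdGaussianVector n) where
  isGaussian_map := by
    rw [map_pi_eq_stdGaussian]
    infer_instance

lemma covariance_dot {n : ℕ} (x y : Fin n → ℝ) :
    cov[fun a => dot x a, fun a => dot y a; stdGaussianVector n] = dot x y := by
  have h := covarianceBilin_apply_eq_cov (μ := stdGaussian (EuclideanSpace ℝ (Fin n)))
    IsGaussian.memLp_two_id (WithLp.toLp 2 x) (WithLp.toLp 2 y)
  rw [covarianceBilin_stdGaussian, ← map_pi_eq_stdGaussian,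
    covariance_map (by fun_prop) (by fun_prop) (by fun_prop)] at h
  simp only [Function.comp_def, ← dot_eq_inner] at h
  rw [← h, dot_eq_inner]
  rfl

lemma hasGaussianLaw_dot_prod {n : ℕ} (x y : Fin n → ℝ) :
    HasGaussianLaw (fun a => (dot x a, dot y a)) (stdGaussianVector n) := by
  have := (hasGaussianLaw_toLp n).map_fun
    ((innerSL ℝ (WithLp.toLp 2 x)).prod (innerSL ℝ (WithLp.toLp 2 y)))
  simpa [← dot_eq_inner] using this

lemma map_dot {n : ℕ} (x : Fin n → ℝ) :
    (stdGaussianVector n).map (fun a => dot x a) = gaussianReal 0 (dot x x).toNNReal := by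
  rw [(hasGaussianLaw_dot_prod x x).fst.map_eq_gaussianReal, ← covariance_self, covariance_dot]
  · congr 1
    have h := integral_strongDual_stdGaussian (E := EuclideanSpace ℝ (Fin n))
      (innerSL ℝ (WithLp.toLp 2 x))
    rw [← map_pi_eq_stdGaussian, integral_map (by fun_prop) (by fun_prop)] at h
    simpa [← dot_eq_inner] using h
  · exact (hasGaussianLaw_dot_prod x x).fst.aemeasurable

/-- Small-ball times tail estimate for two orthogonal Gaussian marginals. -/
lemma le_stdGaussianVector_real {n : ℕ} {u w : Fin n → ℝ} (hu : dot u u = 1) (huw : dot u w = 0)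
    {s t : ℝ} (hs : 0 ≤ s) (hst : s ≤ t) (ht : t ≤ 2) :
    (t - s) / 400 ≤ (stdGaussianVector n).real
      {a | dot u a ∈ Set.Icc s t ∧ l2norm w ≤ dot w a} := by
  have hind : IndepFun (fun a => dot u a) (fun a => dot w a) (stdGaussianVector n) :=
    (hasGaussianLaw_dot_prod u w).indepFun_of_covariance_eq_zero
      (by rw [covariance_dot, huw])
  have hm : ∀ x : Fin n → ℝ, Measurable (fun a => dot x a) := fun x => by
    unfold dot; fun_prop
  have h := congrArg ENNReal.toReal (hind.measure_inter_preimage_eq_mul (Set.Icc s t)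
    (Set.Ici (l2norm w)) measurableSet_Icc measurableSet_Ici)
  rw [ENNReal.toReal_mul] at h
  have h1 : (t - s) / 20 ≤ (stdGaussianVector n).real ((fun a => dot u a) ⁻¹' Set.Icc s t) := by
    rw [← map_measureReal_apply (hm u) measurableSet_Icc, map_dot, hu, Real.toNNReal_one]
    exact le_gaussianReal_Icc hs hst ht
  have h2 : (1 : ℝ) / 20 ≤ (stdGaussianVector n).real ((fun a => dot w a) ⁻¹' Set.Ici (l2norm w)) := by
    have hw : l2norm w = √((dot w w).toNNReal : ℝ) := by
      have : 0 ≤ dot w w := Finset.sum_nonneg fun i _ => mul_self_nonneg (w i)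
      rw [Real.coe_toNNReal _ this]
      simp [l2norm, dot, sq]
    rw [← map_measureReal_apply (hm w) measurableSet_Ici, map_dot, hw]
    exact le_gaussianReal_Ici _
  calc (t - s) / 400 = (t - s) / 20 * (1 / 20) := by ring
    _ ≤ _ := mul_le_mul h1 h2 (by norm_num) measureReal_nonneg
    _ = _ := h.symm

lemma measurable_dot {n : ℕ} (x : Fin n → ℝ) : Measurable fun a : Fin n → ℝ => dot a x := by
  unfold dot; fun_prop

lemma dot_comm {n : ℕ} (x y : Fin n → ℝ) : dot x y = dot y x := by
  simp [dot, mul_comm]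

lemma dot_add_right {n : ℕ} (x y z : Fin n → ℝ) : dot x (y + z) = dot x y + dot x z := by
  simp [dot, mul_add, Finset.sum_add_distrib]

lemma dot_sub_right {n : ℕ} (x y z : Fin n → ℝ) : dot x (y - z) = dot x y - dot x z := by
  simp [dot, mul_sub, Finset.sum_sub_distrib]

lemma dot_smul_right {n : ℕ} (c : ℝ) (x y : Fin n → ℝ) : dot x (c • y) = c * dot x y := by
  simp only [dot, Pi.smul_apply, smul_eq_mul, Finset.mul_sum]
  exact Finset.sum_congr rfl fun i _ => by ring

/-- With high probability all columns of a Gaussian matrix have squared norm at most `8 m`. -/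
lemma stdGaussianVectors_real_column_le (m n : ℕ) :
    (stdGaussianVectors m n).real {a | ∃ j, 8 * (m : ℝ) ≤ ∑ i, a i j ^ 2} ≤
      n * Real.exp (-m) := by
  have hset : {a : Fin m → Fin n → ℝ | ∃ j, 8 * (m : ℝ) ≤ ∑ i, a i j ^ 2} =
      ⋃ j ∈ (Finset.univ : Finset (Fin n)), {a | 8 * (m : ℝ) ≤ ∑ i, a i j ^ 2} := by
    ext; simp
  rw [hset]
  refine (measureReal_biUnion_finset_le _ _).trans ?_
  refine (Finset.sum_le_card_nsmul _ _ (Real.exp (-m)) fun j _ => ?_).trans (by simp)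
  have hmp := measurePreserving_eval (fun _ : Fin n => gaussianReal 0 1) j
  have hint : Integrable (fun x : Fin n → ℝ => Real.exp (x j ^ 2 / 4)) (stdGaussianVector n) :=
    hmp.integrable_comp_of_integrable integrable_exp_sq_gaussianReal
  have hval : ∫ x : Fin n → ℝ, Real.exp (x j ^ 2 / 4) ∂(stdGaussianVector n) = √2 := by
    rw [← integral_exp_sq_gaussianReal, ← hmp.map_eq,
      integral_map hmp.measurable.aemeasurable (by fun_prop)]
  have h := pi_real_le_sum_le (stdGaussianVector n) (fun x => x j ^ 2 / 4) hint m (2 * m)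
  rw [hval] at h
  have hs : √2 ≤ Real.exp 1 :=
    (Real.sqrt_le_left (by positivity)).2 (by nlinarith [Real.add_one_le_exp 1])
  calc _ ≤ _ := measureReal_mono (by
          intro a ha
          simp only [Set.mem_ofPred_eq, ← Finset.sum_div] at ha ⊢
          linarith)
    _ ≤ _ := h
    _ ≤ Real.exp (-(2 * m)) * Real.exp 1 ^ m := by gcongr
    _ = Real.exp (-m) := by
        rw [← Real.exp_nat_mul, ← Real.exp_add]; congr 1; ring

/-- For a direction `z` whose negative is not close to `u`, it is unlikely that `⟨a i, z⟩` is
small whenever `⟨a i, u⟩` is positive. -/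
lemma stdGaussianVectors_real_sum_posPart_le {n : ℕ} (m : ℕ) {u z : Fin n → ℝ} {ε τ : ℝ} (B : ℝ)
    (hu : dot u u = 1) (hε : 0 < ε) (hε2 : ε ≤ 2) (hτ : 0 < τ)
    (h : ∀ g ∈ Set.Icc (ε / 2) ε, τ ≤ g * dot u z + l2norm (z - dot u z • u)) :
    (stdGaussianVectors m n).real
        {a | ∑ i, (if 0 < dot (a i) u then max (dot (a i) z) 0 ^ 2 else 0) ≤ B} ≤
      Real.exp (B / τ ^ 2 - m * (ε / 1600)) := by
  set F : (Fin n → ℝ) → ℝ := fun a => if 0 < dot a u then max (dot a z) 0 ^ 2 else 0 with hF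
  set w := z - dot u z • u with hw
  have hFm : Measurable F :=
    Measurable.ite (measurableSet_lt measurable_const (measurable_dot u))
      (((measurable_dot z).max measurable_const).pow_const 2) measurable_const
  have hF0 : ∀ a, 0 ≤ F a := fun a => by simp only [hF]; split_ifs <;> positivity
  set G : Set (Fin n → ℝ) := {a | dot u a ∈ Set.Icc (ε / 2) ε ∧ l2norm w ≤ dot w a} with hG
  have hGm : MeasurableSet G := by
    simp only [hG, dot_comm u, dot_comm w]
    exact (measurable_dot u measurableSet_Icc).inter (measurable_dot w measurableSet_Ici)
  have hGp : ε / 800 ≤ (stdGaussianVector n).real G := by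
    have huw : dot u w = 0 := by
      rw [hw, dot_sub_right, dot_smul_right, hu]; ring
    have := le_stdGaussianVector_real hu huw (s := ε / 2) (t := ε) (by linarith) (by linarith) hε2
    linarith
  have hGF : ∀ a ∈ G, τ ^ 2 ≤ F a := by
    intro a ha
    have h1 := h _ ha.1
    have h2 : dot a z = dot u a * dot u z + dot w a := by
      rw [dot_comm w, hw, dot_sub_right, dot_smul_right, dot_comm a u]; ring
    have h3 : 0 < dot a u := by rw [dot_comm]; linarith [ha.1.1]
    simp only [hF, if_pos h3]
    have h4 : τ ≤ dot a z := by rw [h2]; linarith [ha.2]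
    exact pow_le_pow_left₀ hτ.le (h4.trans (le_max_left _ _)) 2
  have hpt : ∀ a, Real.exp (-F a / τ ^ 2) ≤ 1 - G.indicator (fun _ => (1 : ℝ) / 2) a := by
    intro a
    by_cases ha : a ∈ G
    · rw [Set.indicator_of_mem ha]
      have h1 : Real.exp (-F a / τ ^ 2) ≤ Real.exp (-1) := by
        rw [Real.exp_le_exp, neg_div, neg_le_neg_iff, le_div_iff₀ (by positivity), one_mul]
        exact hGF a ha
      have h2 : Real.exp (-1) ≤ 1 / 2 := by
        rw [Real.exp_neg, inv_le_comm₀ (Real.exp_pos _) (by norm_num)]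
        linarith [Real.add_one_le_exp 1]
      linarith
    · rw [Set.indicator_of_notMem ha, sub_zero, Real.exp_le_one_iff, neg_div]
      exact neg_nonpos.2 (div_nonneg (hF0 a) (sq_nonneg τ))
  have hint : Integrable (fun a => Real.exp (-F a / τ ^ 2)) (stdGaussianVector n) := by
    refine Integrable.of_bound (by fun_prop) 1 (ae_of_all _ fun a => ?_)
    rw [Real.norm_eq_abs, abs_of_pos (Real.exp_pos _), Real.exp_le_one_iff, neg_div]
    exact neg_nonpos.2 (div_nonneg (hF0 a) (sq_nonneg τ))
  have hI : ∫ a, Real.exp (-F a / τ ^ 2) ∂(stdGaussianVector n) ≤ Real.exp (-(ε / 1600)) := by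
    calc _ ≤ ∫ a, (1 - G.indicator (fun _ => (1 : ℝ) / 2) a) ∂(stdGaussianVector n) :=
          integral_mono hint ((integrable_const _).sub
            ((integrable_const _).indicator hGm)) hpt
      _ = 1 - (stdGaussianVector n).real G / 2 := by
          rw [integral_sub (integrable_const _) ((integrable_const _).indicator hGm),
            integral_indicator_const _ hGm]
          simp [div_eq_mul_inv]
      _ ≤ -(ε / 1600) + 1 := by linarith
      _ ≤ _ := Real.add_one_le_exp _
  have hmain := pi_real_le_sum_le (stdGaussianVector n) (fun a => -F a / τ ^ 2) hint m (-(B / τ ^ 2))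
  calc _ ≤ _ := measureReal_mono (by
          intro a ha
          simp only [Set.mem_ofPred_eq] at ha ⊢
          rw [← Finset.sum_div, Finset.sum_neg_distrib, neg_div, neg_le_neg_iff]
          gcongr)
    _ ≤ _ := hmain
    _ ≤ Real.exp (- -(B / τ ^ 2)) * Real.exp (-(ε / 1600)) ^ m := by
        gcongr
    _ = _ := by
        rw [← Real.exp_nat_mul, ← Real.exp_add]; congr 1; ring

/-- Greedy form of Maurey's empirical method: a convex combination of vectors of norm at most `R`
is approximated by an average of `N` of them with error at most `2 R / √N`. -/
lemma exists_nat_sum_smul_approx {ι E : Type*} [Fintype ι] [NormedAddCommGroup E]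
    [InnerProductSpace ℝ E] (v : ι → E) (p : ι → ℝ) (hp : ∀ j, 0 ≤ p j) (hp1 : ∑ j, p j = 1)
    {R : ℝ} (hR : ∀ j, ‖v j‖ ≤ R) (N : ℕ) :
    ∃ c : ι → ℕ, ∑ j, c j = N ∧
      ‖∑ j, (c j : ℝ) • v j - (N : ℝ) • ∑ j, p j • v j‖ ^ 2 ≤ N * (2 * R) ^ 2 := by
  classical
  set y := ∑ j, p j • v j with hy
  have hyR : ‖y‖ ≤ R := by
    calc ‖y‖ ≤ ∑ j, ‖p j • v j‖ := norm_sum_le _ _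
      _ ≤ ∑ j, p j * R := by
          refine Finset.sum_le_sum fun j _ => ?_
          rw [norm_smul, Real.norm_of_nonneg (hp j)]
          exact mul_le_mul_of_nonneg_left (hR j) (hp j)
      _ = R := by rw [← Finset.sum_mul, hp1, one_mul]
  induction N with
  | zero => exact ⟨0, by simp, by simp⟩
  | succ N ih =>
    obtain ⟨c, hc, hcb⟩ := ih
    set D := ∑ j, (c j : ℝ) • v j - (N : ℝ) • y with hD
    have hzero : ∑ j, p j * inner ℝ D (v j - y) = 0 := by
      simp only [inner_sub_right, mul_sub, Finset.sum_sub_distrib, ← Finset.sum_mul, hp1, one_mul]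
      rw [hy, inner_sum]
      simp [inner_smul_right]
    obtain ⟨j, hj⟩ : ∃ j, inner ℝ D (v j - y) ≤ 0 := by
      by_contra! hcon
      obtain ⟨j, -, hj⟩ : ∃ j ∈ Finset.univ, 0 < p j := by
        by_contra! hle
        have := Finset.sum_nonpos hle
        linarith
      have : 0 < ∑ j, p j * inner ℝ D (v j - y) :=
        Finset.sum_pos' (fun i _ => mul_nonneg (hp i) (hcon i).le)
          ⟨j, Finset.mem_univ _, mul_pos hj (hcon j)⟩
      linarith
    refine ⟨c + Pi.single j 1, by simp [Finset.sum_add_distrib, hc], ?_⟩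
    have hstep : ∑ i, ((c + Pi.single j 1 : ι → ℕ) i : ℝ) • v i - ((N + 1 : ℕ) : ℝ) • y =
        D + (v j - y) := by
      have : ∑ i, ((Pi.single j 1 : ι → ℕ) i : ℝ) • v i = v j := by
        rw [Finset.sum_eq_single j] <;> simp +contextual
      simp only [Pi.add_apply, Nat.cast_add, add_smul, Finset.sum_add_distrib, this, hD,
        Nat.cast_one, one_smul]
      abel
    rw [hstep, norm_add_sq_real]
    have hvy : ‖v j - y‖ ^ 2 ≤ (2 * R) ^ 2 :=
      pow_le_pow_left₀ (norm_nonneg _) ((norm_sub_le _ _).trans (by linarith [hR j])) 2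
    push_cast
    linarith

/-- Lattice approximation of a unit `ℓ¹` vector that is simultaneously accurate for all
measurements in a mean square sense. -/
lemma exists_int_approx {m n : ℕ} (a : Fin m → Fin n → ℝ) (h : Fin n → ℝ) (h1 : l1norm h = 1)
    {K : ℝ} (hK : ∀ j, ∑ i, a i j ^ 2 ≤ K * m) {N : ℕ} (hN : 0 < N) :
    ∃ z : Fin n → ℤ, ∑ j, |z j| ≤ N ∧
      ∑ i, dot (a i) ((N : ℝ)⁻¹ • (fun j => (z j : ℝ)) - h) ^ 2 +
        m * l2norm ((N : ℝ)⁻¹ • (fun j => (z j : ℝ)) - h) ^ 2 ≤ 4 * (K + 1) / N * m := by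
  have hN' : (0 : ℝ) < N := by exact_mod_cast hN
  obtain ⟨s, hs1, hsh⟩ : ∃ s : Fin n → ℤ, (∀ j, |s j| = 1) ∧ ∀ j, |h j| * s j = h j := by
    refine ⟨fun j => if 0 ≤ h j then 1 else -1, fun j => ?_, fun j => ?_⟩
    · dsimp only; split_ifs <;> simp
    · dsimp only; split_ifs with hj
      · simp [abs_of_nonneg hj]
      · simp [abs_of_neg (not_le.1 hj)]
  have hs2 : ∀ j, (s j : ℝ) ^ 2 = 1 := fun j => by
    rw [← sq_abs]; exact_mod_cast by rw [hs1 j]; norm_num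
  let T : (Fin n → ℝ) → EuclideanSpace ℝ (Fin m ⊕ Fin n) := fun x =>
    WithLp.toLp 2 (Sum.elim (fun i => dot (a i) x) fun l => √m * x l)
  have hTsum : ∀ q : Fin n → ℝ,
      ∑ j, q j • T (Pi.single j (s j : ℝ)) = T fun j => q j * s j := by
    intro q
    ext i
    rcases i with i | l
    · simp [T, dot, Pi.single_apply]
      exact Finset.sum_congr rfl fun i _ => by ring
    · simp [T, Pi.single_apply]
      ring
  have hTnorm : ∀ x, ‖T x‖ ^ 2 = ∑ i, dot (a i) x ^ 2 + m * l2norm x ^ 2 := by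
    intro x
    rw [EuclideanSpace.real_norm_sq_eq, Fintype.sum_sum_type, l2norm,
      Real.sq_sqrt (Finset.sum_nonneg fun _ _ => sq_nonneg _), Finset.mul_sum]
    simp [T, mul_pow]
  have hR : ∀ j, ‖T (Pi.single j (s j : ℝ))‖ ≤ √((K + 1) * m) := by
    intro j
    refine Real.le_sqrt_of_sq_le ?_
    rw [hTnorm]
    have e1 : ∑ i, dot (a i) (Pi.single j (s j : ℝ)) ^ 2 = ∑ i, a i j ^ 2 := by
      simp [dot, Pi.single_apply, mul_pow, hs2]
    have e2 : l2norm (Pi.single j (s j : ℝ)) ^ 2 = 1 := by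
      rw [l2norm, Real.sq_sqrt (Finset.sum_nonneg fun _ _ => sq_nonneg _)]
      simp [Pi.single_apply, hs2]
    rw [e1, e2]
    linarith [hK j]
  obtain ⟨c, hc, hcb⟩ := exists_nat_sum_smul_approx (fun j => T (Pi.single j (s j : ℝ)))
    (fun j => |h j|) (fun j => abs_nonneg _) h1 hR N
  rw [hTsum, hTsum] at hcb
  refine ⟨fun j => c j * s j, ?_, ?_⟩
  · simp only [abs_mul, hs1, mul_one, Nat.abs_cast]
    exact_mod_cast hc.le
  · have hT : T (fun j => (c j : ℝ) * s j) - (N : ℝ) • T (fun j => |h j| * s j) =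
        (N : ℝ) • T ((N : ℝ)⁻¹ • (fun j => (((c j * s j : ℤ)) : ℝ)) - h) := by
      simp only [hsh]
      ext i
      rcases i with i | l
      · simp only [T, PiLp.sub_apply, PiLp.smul_apply, Sum.elim_inl, smul_eq_mul, dot_sub_right,
          dot_smul_right]
        field_simp
        push_cast
        ring
      · simp only [T, PiLp.sub_apply, PiLp.smul_apply, Sum.elim_inr, smul_eq_mul, Pi.sub_apply,
          Pi.smul_apply]
        field_simp
        push_cast
        ring
    have hK0 : 0 ≤ (K + 1) * m := by
      by_contra! hneg
      by_cases hn : Nonempty (Fin n)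
      · obtain ⟨j⟩ := hn
        have := hK j
        have : 0 ≤ ∑ i, a i j ^ 2 := Finset.sum_nonneg fun _ _ => sq_nonneg _
        have : (0 : ℝ) ≤ m := by positivity
        linarith
      · rw [not_nonempty_iff] at hn
        simp [l1norm] at h1
    rw [hT, norm_smul, mul_pow, hTnorm, mul_pow, Real.sq_sqrt hK0, Real.norm_of_nonneg hN'.le] at hcb
    rw [div_mul_eq_mul_div, le_div_iff₀ hN']
    refine le_of_mul_le_mul_left ?_ hN'
    linarith

/-- The integer points of the `ℓ¹` ball of radius `N` in `ℝⁿ`. -/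
noncomputable def l1LatticeBall (n N : ℕ) : Finset (Fin n → ℤ) :=
  (Fintype.piFinset fun _ => Finset.Icc (-(N : ℤ)) N).filter fun z => ∑ j, |z j| ≤ (N : ℤ)

lemma mem_l1LatticeBall {n N : ℕ} {z : Fin n → ℤ} :
    z ∈ l1LatticeBall n N ↔ ∑ j, |z j| ≤ (N : ℤ) := by
  simp only [l1LatticeBall, Finset.mem_filter, Fintype.mem_piFinset, Finset.mem_Icc, ← abs_le,
    and_iff_right_iff_imp]
  exact fun h j => (Finset.single_le_sum (fun i _ => abs_nonneg (z i)) (Finset.mem_univ j)).trans h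

/-- The number of lattice points in an `ℓ¹` ball, via the generating function. -/
lemma card_l1LatticeBall_le (n N : ℕ) {x : ℝ} (hx0 : 0 < x) (hx : x ≤ 1 / 3) :
    ((l1LatticeBall n N).card : ℝ) ≤ Real.exp (N * Real.log x⁻¹ + 3 * x * n) := by
  have hone : ∑ l ∈ Finset.Icc (-(N : ℤ)) N, x ^ l.natAbs ≤ Real.exp (3 * x) := by
    have heven : Function.Even fun l : ℤ => x ^ l.natAbs := fun l => by simp
    rw [Finset.sum_Icc_of_even_eq_range heven]
    have hg : ∑ l ∈ Finset.range (N + 1), x ^ l ≤ (1 - x)⁻¹ := by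
      rw [← tsum_geometric_of_lt_one hx0.le (by linarith)]
      exact (summable_geometric_of_lt_one hx0.le (by linarith)).sum_le_tsum _
        fun _ _ => by positivity
    have hg' : (1 - x)⁻¹ ≤ 1 + 3 / 2 * x := by
      rw [inv_le_iff_one_le_mul₀ (by linarith)]; nlinarith
    simp only [Int.natAbs_natCast, Int.natAbs_zero, pow_zero]
    rw [nsmul_eq_mul]
    push_cast
    linarith [Real.add_one_le_exp (3 * x)]
  have hcount : ((l1LatticeBall n N).card : ℝ) * x ^ N ≤ Real.exp (3 * x) ^ n := by
    calc _ = ∑ z ∈ l1LatticeBall n N, x ^ N := by simp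
      _ ≤ ∑ z ∈ l1LatticeBall n N, ∏ j, x ^ (z j).natAbs := by
          refine Finset.sum_le_sum fun z hz => ?_
          rw [Finset.prod_pow_eq_pow_sum]
          refine pow_le_pow_of_le_one hx0.le (by linarith) ?_
          have := mem_l1LatticeBall.1 hz
          zify
          exact this
      _ ≤ ∑ z ∈ Fintype.piFinset (fun _ : Fin n => Finset.Icc (-(N : ℤ)) N),
          ∏ j, x ^ (z j).natAbs := by
          refine Finset.sum_le_sum_of_subset_of_nonneg ?_ fun _ _ _ =>
            Finset.prod_nonneg fun _ _ => pow_nonneg hx0.le _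
          unfold l1LatticeBall
          exact Finset.filter_subset _ _
      _ = ∏ _j : Fin n, ∑ l ∈ Finset.Icc (-(N : ℤ)) N, x ^ l.natAbs :=
          (Finset.prod_univ_sum (fun _ : Fin n => Finset.Icc (-(N : ℤ)) N)
            fun _ l => x ^ l.natAbs).symm
      _ ≤ _ := by
          rw [Finset.prod_const, Finset.card_univ, Fintype.card_fin]
          gcongr
  rw [Real.exp_add, Real.exp_nat_mul, Real.exp_log (by positivity), mul_comm (3 * x) (n : ℝ),
    Real.exp_nat_mul, inv_pow, inv_mul_eq_div, le_div_iff₀ (by positivity)]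
  exact hcount

lemma l2norm_nonneg {n : ℕ} (x : Fin n → ℝ) : 0 ≤ l2norm x := Real.sqrt_nonneg _

lemma l2norm_sq {n : ℕ} (x : Fin n → ℝ) : l2norm x ^ 2 = dot x x := by
  rw [l2norm, Real.sq_sqrt (Finset.sum_nonneg fun _ _ => sq_nonneg _)]
  simp [dot, sq]

lemma l2norm_add_le {n : ℕ} (x y : Fin n → ℝ) : l2norm (x + y) ≤ l2norm x + l2norm y := by
  simpa [l2norm_eq_norm] using norm_add_le (WithLp.toLp 2 x) (WithLp.toLp 2 y)

lemma l2norm_smul {n : ℕ} (c : ℝ) (x : Fin n → ℝ) : l2norm (c • x) = |c| * l2norm x := by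
  simp [l2norm_eq_norm, norm_smul]

lemma abs_dot_le {n : ℕ} (x y : Fin n → ℝ) : |dot x y| ≤ l2norm x * l2norm y := by
  simpa [l2norm_eq_norm, dot_eq_inner] using
    abs_real_inner_le_norm (WithLp.toLp 2 x) (WithLp.toLp 2 y)

/-- Directions along which the SparsePhaseMax objective does not decrease are effectively sparse
and bounded away from `-u`. -/
lemma le_add_l2norm_of_descent {n : ℕ} {φ u σ h : Fin n → ℝ} {α s lam q g : ℝ}
    (hφ : l2norm φ = 1) (hu : l2norm u = 1) (hα : dot φ u = α) (hα0 : 0 < α) (hs : 0 < s)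
    (hσ : l2norm σ ≤ s) (hl1 : α / 2 < lam * s) (hl2 : lam * s < 3 / 4 * α) (hq : 0 ≤ q)
    (hhq : l1norm h ≤ q + s * l2norm h) (hcone : lam * (q + dot σ h) ≤ dot φ h)
    (hg : g ∈ Set.Icc (α / 16 / 2) (α / 16)) :
    α ^ 2 / (128 * s) * l1norm h ≤ g * dot u h + l2norm (h - dot u h • u) := by
  have hα1 : α ≤ 1 := by
    have := (le_abs_self _).trans (abs_dot_le φ u)
    rw [hφ, hu, hα] at this
    linarith
  have hlam : 0 < lam := by
    by_contra! hneg
    nlinarith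
  set t := dot u h with ht
  set w := h - t • u with hw
  have hh : h = t • u + w := by rw [hw]; abel
  have hr := l2norm_nonneg w
  have hh2 : l2norm h ≤ |t| + l2norm w := by
    calc l2norm h ≤ l2norm (t • u) + l2norm w := by
          conv_lhs => rw [hh]
          exact l2norm_add_le _ _
      _ = |t| + l2norm w := by rw [l2norm_smul, hu, mul_one]
  have hσu := abs_le.1 ((abs_dot_le σ u).trans (by rw [hu, mul_one]))
  have hσw := abs_le.1 ((abs_dot_le σ w).trans (mul_le_mul_of_nonneg_right hσ hr))
  have hσh := abs_le.1 ((abs_dot_le σ h).trans (mul_le_mul_of_nonneg_right hσ (l2norm_nonneg h)))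
  have hφw := abs_le.1 ((abs_dot_le φ w).trans_eq (by rw [hφ, one_mul]))
  have hφh := abs_le.1 ((abs_dot_le φ h).trans_eq (by rw [hφ, one_mul]))
  have hsparse : α * l1norm h ≤ 4 * s * l2norm h := by
    have hX := l2norm_nonneg h
    have hsX : 0 ≤ s * l2norm h := by positivity
    have h1 : lam * (q - s * l2norm h) ≤ l2norm h := by nlinarith
    have h2 : α * (q - s * l2norm h) ≤ 2 * (s * l2norm h) := by
      rcases le_or_gt (q - s * l2norm h) 0 with hle | hlt
      · nlinarith
      · have h3 : α / 2 * (q - s * l2norm h) ≤ lam * s * (q - s * l2norm h) := by gcongr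
        have h4 : s * (lam * (q - s * l2norm h)) ≤ s * l2norm h := by gcongr
        linarith
    have h5 : α * l1norm h ≤ α * (q + s * l2norm h) := by gcongr
    have h6 : α * (s * l2norm h) ≤ 1 * (s * l2norm h) := by gcongr
    linarith
  have hangle : -t * α ≤ 7 * l2norm w := by
    rcases le_or_gt 0 t with ht0 | ht0
    · nlinarith
    have e1 : dot σ h = t * dot σ u + dot σ w := by
      conv_lhs => rw [hh]
      rw [dot_add_right, dot_smul_right]
    have e2 : dot φ h = t * α + dot φ w := by
      conv_lhs => rw [hh]
      rw [dot_add_right, dot_smul_right, hα]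
    rw [e1, e2] at hcone
    have h1 : t * s ≤ t * dot σ u := mul_le_mul_of_nonpos_left (hσu.2.trans hσ) ht0.le
    have h2 : lam * (t * s - s * l2norm w) ≤ t * α + l2norm w := by
      calc lam * (t * s - s * l2norm w) ≤ lam * (q + (t * dot σ u + dot σ w)) := by
            exact mul_le_mul_of_nonneg_left (by linarith) hlam.le
        _ ≤ t * α + dot φ w := hcone
        _ ≤ _ := by linarith
    have h3 : 3 / 4 * α * t ≤ lam * s * t := mul_le_mul_of_nonpos_right hl2.le ht0.le
    have h4 : lam * s * l2norm w ≤ 3 / 4 * l2norm w :=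
      mul_le_mul_of_nonneg_right (by linarith) hr
    have h5 : 3 / 4 * l2norm w + l2norm w = 7 / 4 * l2norm w := by ring
    linarith
  have hmain : α / 32 * l2norm h ≤ g * t + l2norm w := by
    obtain ⟨hg1, hg2⟩ := hg
    have h2 : α / 32 * l2norm h ≤ α / 32 * (|t| + l2norm w) := by gcongr
    have h3 : α / 32 * l2norm w ≤ 1 / 32 * l2norm w := by gcongr
    rcases le_or_gt 0 t with ht0 | ht0
    · rw [abs_of_nonneg ht0] at h2
      have h1 : α / 32 * t ≤ g * t := mul_le_mul_of_nonneg_right (by linarith) ht0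
      linarith
    · rw [abs_of_neg ht0] at h2
      have h1 : α / 16 * t ≤ g * t := mul_le_mul_of_nonpos_right hg2 ht0.le
      linarith
  calc α ^ 2 / (128 * s) * l1norm h = α / (128 * s) * (α * l1norm h) := by ring
    _ ≤ α / (128 * s) * (4 * s * l2norm h) := by gcongr
    _ = α / 32 * l2norm h := by field_simp; ring
    _ ≤ _ := hmain

lemma le_add_l2norm_of_near {n : ℕ} {u h z : Fin n → ℝ} {τ η g : ℝ} (hu : l2norm u = 1)
    (hg0 : 0 ≤ g) (hg1 : g ≤ 1) (hz : l2norm (z - h) ≤ η)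
    (hτ : τ ≤ g * dot u h + l2norm (h - dot u h • u)) :
    τ - 3 * η ≤ g * dot u z + l2norm (z - dot u z • u) := by
  have hd : |dot u (z - h)| ≤ η := (abs_dot_le _ _).trans (by rw [hu, one_mul]; exact hz)
  have h1 : h - dot u h • u = (z - dot u z • u) + (dot u (z - h) • u + (-1 : ℝ) • (z - h)) := by
    rw [dot_sub_right]; module
  have h2 := (l2norm_add_le (z - dot u z • u) (dot u (z - h) • u + (-1 : ℝ) • (z - h)))
  have h3 := l2norm_add_le (dot u (z - h) • u) ((-1 : ℝ) • (z - h))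
  rw [← h1] at h2
  rw [l2norm_smul, l2norm_smul, hu] at h3
  rw [abs_neg, abs_one, one_mul, mul_one] at h3
  have h4 : dot u h = dot u z - dot u (z - h) := by rw [dot_sub_right]; ring
  have h5 : -η ≤ g * dot u (z - h) := by
    have := abs_le.1 hd
    nlinarith [abs_nonneg (dot u (z - h))]
  have h6 : l2norm (dot u (z - h) • u + (-1 : ℝ) • (z - h)) ≤ 2 * η := by linarith
  have h7 : g * dot u h = g * dot u z - g * dot u (z - h) := by rw [h4]; ring
  linarith

/-- The subgradient inequality for the `ℓ¹` norm at a vector with at most `k` nonzero entries. -/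
lemma exists_l1norm_subgradient {n k : ℕ} {x0 : Fin n → ℝ}
    (hx0 : (Function.support x0).ncard ≤ k) :
    ∃ σ : Fin n → ℝ, l2norm σ ≤ √k ∧ ∀ h : Fin n → ℝ, ∃ q : ℝ, 0 ≤ q ∧
      l1norm h ≤ q + √k * l2norm h ∧ q + dot σ h ≤ l1norm (x0 + h) - l1norm x0 := by
  classical
  set I : Fin n → ℝ := fun j => if x0 j = 0 then 0 else 1 with hI
  have hcard : ∑ j, I j ≤ k := by
    have : (Function.support x0) = ↑(Finset.univ.filter fun j => ¬ x0 j = 0) := by ext; simp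
    rw [this, Set.ncard_coe_finset] at hx0
    have : ∑ j, I j = ((Finset.univ.filter fun j => ¬ x0 j = 0).card : ℝ) := by
      simp [hI, Finset.sum_ite]
    rw [this]
    exact_mod_cast hx0
  have hIn : l2norm I ≤ √k := by
    refine Real.sqrt_le_sqrt (le_trans (le_of_eq ?_) hcard)
    exact Finset.sum_congr rfl fun j _ => by simp only [hI]; split_ifs <;> simp
  refine ⟨fun j => x0 j / |x0 j|, ?_, fun h => ⟨∑ j, (1 - I j) * |h j|, ?_, ?_, ?_⟩⟩
  · refine Real.sqrt_le_sqrt (le_trans (le_of_eq ?_) hcard)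
    refine Finset.sum_congr rfl fun j _ => ?_
    simp only [hI]
    split_ifs with hj
    · simp [hj]
    · rw [div_pow, sq_abs, div_self (pow_ne_zero 2 hj)]
  · refine Finset.sum_nonneg fun j _ => mul_nonneg ?_ (abs_nonneg _)
    simp only [hI]; split_ifs <;> simp
  · have h1 : dot I (fun j => |h j|) ≤ √k * l2norm h := by
      have h2 : l2norm (fun j => |h j|) = l2norm h := by simp [l2norm]
      refine (le_abs_self _).trans ((abs_dot_le _ _).trans ?_)
      rw [h2]
      exact mul_le_mul_of_nonneg_right hIn (l2norm_nonneg h)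
    have h3 : l1norm h = ∑ j, (1 - I j) * |h j| + dot I (fun j => |h j|) := by
      rw [l1norm, dot, ← Finset.sum_add_distrib]
      exact Finset.sum_congr rfl fun j _ => by ring
    linarith
  · rw [l1norm, l1norm, dot, ← Finset.sum_add_distrib, ← Finset.sum_sub_distrib]
    refine Finset.sum_le_sum fun j _ => ?_
    simp only [hI, Pi.add_apply]
    split_ifs with hj
    · simp [hj]
    · have h1 : 0 < |x0 j| := abs_pos.2 hj
      have h2 : x0 j / |x0 j| * h j = x0 j / |x0 j| * (x0 j + h j) - |x0 j| := by
        have : x0 j / |x0 j| * x0 j = |x0 j| := by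
          rw [div_mul_eq_mul_div, ← sq, ← sq_abs, sq, mul_div_assoc, div_self h1.ne', mul_one]
        rw [mul_add, this]; ring
      have h3 : x0 j / |x0 j| * (x0 j + h j) ≤ |x0 j + h j| := by
        refine (le_abs_self _).trans ?_
        rw [abs_mul, abs_div, abs_abs, div_self h1.ne', one_mul]
      linarith

/-- If SparsePhaseMax fails, then some lattice direction bounded away from `-u` almost satisfies
all the one-sided constraints. -/
lemma exists_lattice_point_of_not_spmUniqueMax {n m k N : ℕ} {a : Fin m → Fin n → ℝ}
    {x0 φ u : Fin n → ℝ} {lam α : ℝ} (hm : 0 < m) (hk : 0 < k) (hN : 0 < N)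
    (hsupp : (Function.support x0).ncard ≤ k) (hφ : l2norm φ = 1) (hu : l2norm u = 1)
    {r : ℝ} (hr : 0 < r) (hux : x0 = r • u) (hα : dot φ u = α) (hα0 : 0 < α)
    (hl1 : α / 2 < lam * √k) (hl2 : lam * √k < 3 / 4 * α)
    (hcol : ∀ j, ∑ i, a i j ^ 2 ≤ 8 * m) (hNη : 36 / (N : ℝ) ≤ (α ^ 2 / (512 * √k)) ^ 2)
    (hmax : ¬ SPMUniqueMax a x0 φ lam) :
    ∃ z ∈ l1LatticeBall n N,
      (∀ g ∈ Set.Icc (α / 16 / 2) (α / 16), α ^ 2 / (512 * √k) ≤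
        g * dot u ((N : ℝ)⁻¹ • fun j => (z j : ℝ)) +
          l2norm (((N : ℝ)⁻¹ • fun j => (z j : ℝ)) -
            dot u ((N : ℝ)⁻¹ • fun j => (z j : ℝ)) • u)) ∧
      ∑ i, (if 0 < dot (a i) u then max (dot (a i) ((N : ℝ)⁻¹ • fun j => (z j : ℝ))) 0 ^ 2
        else 0) ≤ 36 / N * m := by
  have hα1 : α ≤ 1 := by
    have := (le_abs_self _).trans (abs_dot_le φ u)
    rw [hφ, hu, hα] at this
    linarith
  have hs : 0 < √(k : ℝ) := Real.sqrt_pos.2 (by exact_mod_cast hk)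
  have hm' : (0 : ℝ) < m := by exact_mod_cast hm
  have hlam : 0 < lam := by
    by_contra! hneg
    nlinarith
  unfold SPMUniqueMax at hmax
  push Not at hmax
  obtain ⟨x, hx, hne, hobj⟩ := hmax
  set l := l1norm (x - x0) with hl
  have hl0 : 0 < l := by
    obtain ⟨j, hj⟩ := Function.ne_iff.1 hne
    exact Finset.sum_pos' (fun _ _ => abs_nonneg _)
      ⟨j, Finset.mem_univ _, abs_pos.2 (sub_ne_zero.2 hj)⟩
  set h := l⁻¹ • (x - x0) with hh
  have hxh : x - x0 = l • h := by rw [hh, smul_smul, mul_inv_cancel₀ hl0.ne', one_smul]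
  have h1 : l1norm h = 1 := by
    have : l1norm h = l⁻¹ * l := by
      simp only [hl, l1norm, hh, Pi.smul_apply, smul_eq_mul, abs_mul, ← Finset.mul_sum, abs_inv]
      rw [abs_of_nonneg (Finset.sum_nonneg fun _ _ => abs_nonneg _)]
    rw [this, inv_mul_cancel₀ hl0.ne']
  have hdir : ∀ g ∈ Set.Icc (α / 16 / 2) (α / 16),
      α ^ 2 / (128 * √k) ≤ g * dot u h + l2norm (h - dot u h • u) := by
    intro g hg
    obtain ⟨σ, hσ, hsub⟩ := exists_l1norm_subgradient hsupp
    obtain ⟨q, hq, hhq, hqσ⟩ := hsub (x - x0)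
    have hcone : lam * (q + dot σ (x - x0)) ≤ dot φ (x - x0) := by
      rw [add_sub_cancel] at hqσ
      have := mul_le_mul_of_nonneg_left hqσ hlam.le
      rw [dot_sub_right φ]
      linarith
    have := le_add_l2norm_of_descent hφ hu hα hα0 hs hσ hl1 hl2 hq hhq hcone hg
    rw [← hl, hxh, dot_smul_right, mul_smul, ← smul_sub, l2norm_smul, abs_of_pos hl0] at this
    refine le_of_mul_le_mul_left ?_ hl0
    linarith
  have hcons : ∀ i, 0 < dot (a i) u → dot (a i) h ≤ 0 := by
    intro i hi
    have h2 : 0 < dot (a i) x0 := by rw [hux, dot_smul_right]; positivity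
    have h3 := (hx i).2
    rw [abs_of_pos h2] at h3
    rw [hh, dot_smul_right, dot_sub_right]
    exact mul_nonpos_of_nonneg_of_nonpos (inv_nonneg.2 hl0.le) (by linarith)
  obtain ⟨z, hz, hza⟩ := exists_int_approx a h h1 hcol hN
  set Z := (N : ℝ)⁻¹ • fun j => (z j : ℝ) with hZ
  have hsq : ∀ i, 0 ≤ dot (a i) (Z - h) ^ 2 := fun i => sq_nonneg _
  have hB : 4 * (8 + 1) / (N : ℝ) * m = 36 / N * m := by norm_num
  rw [hB] at hza
  refine ⟨z, mem_l1LatticeBall.2 hz, fun g hg => ?_, ?_⟩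
  · have hη : l2norm (Z - h) ≤ α ^ 2 / (512 * √k) := by
      refine abs_le_of_sq_le_sq' ?_ (by positivity) |>.2
      refine le_trans (le_of_mul_le_mul_left ?_ hm') hNη
      have := Finset.sum_nonneg fun i (_ : i ∈ Finset.univ) => hsq i
      linarith
    have := le_add_l2norm_of_near hu (by linarith [hg.1]) (by linarith [hg.2]) hη (hdir g hg)
    have e : α ^ 2 / (128 * √k) - 3 * (α ^ 2 / (512 * √k)) = α ^ 2 / (512 * √k) := by
      field_simp
      norm_num
    rwa [e] at this
  · have : 0 ≤ m * l2norm (Z - h) ^ 2 := by positivity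
    refine le_trans (Finset.sum_le_sum fun i _ => ?_) (by linarith :
      ∑ i, dot (a i) (Z - h) ^ 2 ≤ 36 / N * m)
    split_ifs with hi
    · rw [← sq_abs (dot (a i) (Z - h))]
      refine pow_le_pow_left₀ (le_max_right _ _) (max_le ?_ (abs_nonneg _)) 2
      have h2 := hcons i hi
      have h3 := dot_sub_right (a i) Z h
      linarith [le_abs_self (dot (a i) (Z - h))]
    · exact hsq i

/-- The failure probability of SparsePhaseMax, in terms of the approximation parameter `N`. -/
lemma stdGaussianVectors_real_not_spmUniqueMax_le {n m k N : ℕ}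
    {x0 φ u : Fin n → ℝ} {lam α : ℝ} (hm : 0 < m) (hk : 0 < k) (hN : 0 < N)
    (hsupp : (Function.support x0).ncard ≤ k) (hφ : l2norm φ = 1) (hu : l2norm u = 1)
    {r : ℝ} (hr : 0 < r) (hux : x0 = r • u) (hα : dot φ u = α) (hα0 : 0 < α)
    (hl1 : α / 2 < lam * √k) (hl2 : lam * √k < 3 / 4 * α)
    (hNη : 36 / (N : ℝ) ≤ (α ^ 2 / (512 * √k)) ^ 2) :
    (stdGaussianVectors m n).real {a | SPMUniqueMax a x0 φ lam}ᶜ ≤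
      n * Real.exp (-m) + (l1LatticeBall n N).card *
        Real.exp (36 / N * m / (α ^ 2 / (512 * √k)) ^ 2 - m * (α / 16 / 1600)) := by
  classical
  have hα1 : α ≤ 1 := by
    have := (le_abs_self _).trans (abs_dot_le φ u)
    rw [hφ, hu, hα] at this
    linarith
  have hs : 0 < √(k : ℝ) := Real.sqrt_pos.2 (by exact_mod_cast hk)
  have huu : dot u u = 1 := by rw [← l2norm_sq, hu, one_pow]
  have : IsProbabilityMeasure (stdGaussianVectors m n) := by
    unfold stdGaussianVectors; infer_instance
  set Z : (Fin n → ℤ) → Fin n → ℝ := fun z => (N : ℝ)⁻¹ • fun j => (z j : ℝ) with hZ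
  set good : (Fin n → ℤ) → Prop := fun z => ∀ g ∈ Set.Icc (α / 16 / 2) (α / 16),
    α ^ 2 / (512 * √k) ≤ g * dot u (Z z) + l2norm (Z z - dot u (Z z) • u) with hgood
  have hsubset : {a : Fin m → Fin n → ℝ | SPMUniqueMax a x0 φ lam}ᶜ ⊆
      {a | ∃ j, 8 * (m : ℝ) ≤ ∑ i, a i j ^ 2} ∪ ⋃ z ∈ (l1LatticeBall n N).filter good,
        {a | ∑ i, (if 0 < dot (a i) u then max (dot (a i) (Z z)) 0 ^ 2 else 0) ≤ 36 / N * m} := by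
    intro a ha
    by_cases hcol : ∃ j, 8 * (m : ℝ) ≤ ∑ i, a i j ^ 2
    · exact Or.inl hcol
    · push Not at hcol
      obtain ⟨z, hz, hzg, hzs⟩ := exists_lattice_point_of_not_spmUniqueMax hm hk hN hsupp hφ hu
        hr hux hα hα0 hl1 hl2 (fun j => (hcol j).le) hNη ha
      exact Or.inr (Set.mem_biUnion (Finset.mem_filter.2 ⟨hz, hzg⟩) hzs)
  refine (measureReal_mono hsubset).trans ((measureReal_union_le _ _).trans
    (add_le_add (stdGaussianVectors_real_column_le m n) ?_))
  refine (measureReal_biUnion_finset_le _ _).trans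
    ((Finset.sum_le_card_nsmul _ _ _ fun z hz =>
      stdGaussianVectors_real_sum_posPart_le m (36 / N * m) huu (by positivity) (by linarith)
        (by positivity) (Finset.mem_filter.1 hz).2).trans ?_)
  rw [nsmul_eq_mul]
  gcongr
  exact Finset.filter_subset _ _

lemma rpow_rate_le {α m k : ℝ} (hα : 0 < α) (hm : 0 ≤ m) (hk : 0 ≤ k) (h : k ≤ α ^ 7 * m) :
    α ^ (-(2 : ℝ) / 5) * m ^ ((4 : ℝ) / 5) * k ^ ((1 : ℝ) / 5) ≤ α * m := by
  have h1 : k ^ ((1 : ℝ) / 5) ≤ α ^ ((7 : ℝ) / 5) * m ^ ((1 : ℝ) / 5) := by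
    refine (Real.rpow_le_rpow hk h (by norm_num)).trans_eq ?_
    rw [Real.mul_rpow (by positivity) hm, ← Real.rpow_natCast, ← Real.rpow_mul hα.le]
    norm_num
  calc _ ≤ α ^ (-(2 : ℝ) / 5) * m ^ ((4 : ℝ) / 5) *
        (α ^ ((7 : ℝ) / 5) * m ^ ((1 : ℝ) / 5)) := by gcongr
    _ = (α ^ (-(2 : ℝ) / 5) * α ^ ((7 : ℝ) / 5)) *
        (m ^ ((4 : ℝ) / 5) * m ^ ((1 : ℝ) / 5)) := by ring
    _ = α * m := by
      rw [← Real.rpow_add hα, ← Real.rpow_add_of_nonneg hm (by norm_num) (by norm_num)]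
      norm_num

lemma one_le_log_div {n k α : ℝ} (hk : 1 ≤ k) (hα1 : α ^ 2 ≤ 1)
    (hkn : k < (1 / 49) * α ^ 2 * n) (hn : 0 ≤ n) :
    49 * k < n ∧ 1 ≤ Real.log (n / k) := by
  have h49 : 49 * k < n := by nlinarith [mul_le_mul_of_nonneg_right hα1 hn]
  refine ⟨h49, ?_⟩
  have hk0 : 0 < k := by linarith
  rw [Real.le_log_iff_exp_le (by apply div_pos <;> linarith), le_div_iff₀ hk0]
  nlinarith [Real.exp_one_lt_d9]

lemma union_bound_exponents_le {n m k N : ℕ} {α C : ℝ} (hα : 0 < α) (hα1 : α ≤ 1) (hk : 1 ≤ k)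
    (hkn : (k : ℝ) < (1 / 49) * α ^ 2 * n) (hC : 1 ≤ C)
    (hm : 819200 * C * (k * Real.log ((n : ℝ) / k)) ≤ α ^ 7 * m)
    (hN1 : (k : ℝ) ≤ N) (hN2 : N * α ^ 5 ≤ 2 * C * k)
    (hN3 : 36 / (N : ℝ) ≤ α / 51200 * (α ^ 2 / (512 * √k)) ^ 2) :
    n * Real.exp (-m) + (l1LatticeBall n N).card *
        Real.exp (36 / N * m / (α ^ 2 / (512 * √k)) ^ 2 - m * (α / 16 / 1600)) ≤
      2 * Real.exp (-(1 / 102400) * (α * m)) := by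
  have hk' : (1 : ℝ) ≤ k := by exact_mod_cast hk
  have hk0 : (0 : ℝ) < k := by linarith
  obtain ⟨h49, hL⟩ := one_le_log_div hk' (pow_le_one₀ hα.le hα1) hkn n.cast_nonneg
  have hn0 : (0 : ℝ) < n := by linarith
  have hm0 : (0 : ℝ) ≤ m := m.cast_nonneg
  set L := Real.log ((n : ℝ) / k) with hLdef
  have hkL : 0 < k * L := by positivity
  have hαm : α * m ≤ m := mul_le_of_le_one_left hm0 hα1
  have hfirst : n * Real.exp (-m) ≤ Real.exp (-(1 / 102400) * (α * m)) := by
    have hlogn : Real.log n ≤ k * L := by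
      have h1 : L = Real.log n - Real.log k := Real.log_div hn0.ne' hk0.ne'
      have h2 := Real.log_le_sub_one_of_pos hk0
      nlinarith [mul_nonneg (sub_nonneg.2 hk') (sub_nonneg.2 hL)]
    have h3 : 819200 * (k * L) ≤ m := by
      have h4 : α ^ 7 * m ≤ m := mul_le_of_le_one_left hm0 (pow_le_one₀ hα.le hα1)
      nlinarith [mul_nonneg (sub_nonneg.2 hC) hkL.le]
    nth_rw 1 [← Real.exp_log hn0]
    rw [← Real.exp_add, Real.exp_le_exp]
    linarith
  have hsecond : (l1LatticeBall n N).card *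
        Real.exp (36 / N * m / (α ^ 2 / (512 * √k)) ^ 2 - m * (α / 16 / 1600)) ≤
      Real.exp (-(1 / 102400) * (α * m)) := by
    have hcard := card_l1LatticeBall_le n N (x := (k : ℝ) / n) (by positivity)
      (by rw [div_le_iff₀ hn0]; linarith)
    rw [inv_div, ← hLdef, mul_assoc, div_mul_cancel₀ _ hn0.ne'] at hcard
    have hNL : N * L * (4 * 102400) ≤ α * m := by
      have h5 : N * L * (4 * 102400) * α ^ 5 ≤ α * m * α ^ 5 := by
        calc N * L * (4 * 102400) * α ^ 5 = N * α ^ 5 * (L * (4 * 102400)) := by ring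
          _ ≤ 2 * C * k * (L * (4 * 102400)) := by gcongr
          _ = 819200 * C * (k * L) := by ring
          _ ≤ α ^ 7 * m := hm
          _ = α * (α * m * α ^ 5) := by ring
          _ ≤ α * m * α ^ 5 := mul_le_of_le_one_left (by positivity) hα1
      exact le_of_mul_le_mul_right h5 (by positivity)
    have hexp : 36 / N * m / (α ^ 2 / (512 * √(k : ℝ))) ^ 2 ≤ α / 51200 * m := by
      rw [div_le_iff₀ (by positivity)]
      nlinarith [mul_le_mul_of_nonneg_right hN3 hm0]
    have hkNL : (k : ℝ) ≤ N * L := hN1.trans (le_mul_of_one_le_right N.cast_nonneg hL)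
    refine (mul_le_mul_of_nonneg_right hcard (Real.exp_pos _).le).trans ?_
    rw [← Real.exp_add, Real.exp_le_exp]
    linarith
  linarith

/-- **Theorem 1 (SparsePhaseMax main theorem).** If `x0` is `k`-sparse, the `a i` are i.i.d.
standard Gaussian vectors, `φ` is a unit anchor vector with correlation `α > 0` with
`x0 / ‖x0‖₂`, `(1/2)·α/√k < λ < (3/4)·α/√k` and `k < (1/49)·α²·n`, then there are universal
positive constants `C₁, C₂, c` such that `m > (C₁/α⁷)·k·log(n/k)` implies that `x0` is the
unique maximizer of SparsePhaseMax with probability at least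
`1 − C₂·exp(−c·α^{−2/5}·m^{4/5}·k^{1/5})`. -/
theorem sparsePhaseMax_main :
    ∃ C₁ C₂ c : ℝ, 0 < C₁ ∧ 0 < C₂ ∧ 0 < c ∧
      ∀ (n m k : ℕ) (x0 φ : Fin n → ℝ) (lam α : ℝ),
        (Function.support x0).ncard ≤ k →
        l2norm φ = 1 →
        dot φ ((l2norm x0)⁻¹ • x0) = α →
        0 < α →
        (1 / 2) * α / Real.sqrt k < lam →
        lam < (3 / 4) * α / Real.sqrt k →
        (k : ℝ) < (1 / 49) * α ^ 2 * n →
        (m : ℝ) > C₁ / α ^ 7 * k * Real.log ((n : ℝ) / k) →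
        stdGaussianVectors m n {a : Fin m → Fin n → ℝ | SPMUniqueMax a x0 φ lam} ≥
          ENNReal.ofReal
            (1 - C₂ * Real.exp
              (-c * α ^ (-(2 : ℝ) / 5) * (m : ℝ) ^ ((4 : ℝ) / 5) * (k : ℝ) ^ ((1 : ℝ) / 5))) := by
  refine ⟨819200 * (36 * 262144 * 51200), 2, 1 / 102400, by norm_num, by norm_num, by norm_num, ?_⟩
  intro n m k x0 φ lam α hsupp hφ hα hα0 hl1 hl2 hkn hm
  obtain ⟨C, hC⟩ : ∃ C : ℝ, C = 36 * 262144 * 51200 := ⟨_, rfl⟩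
  rw [← hC] at hm
  have hr : 0 < l2norm x0 := by
    refine (l2norm_nonneg x0).lt_of_ne' fun h => hα0.ne ?_
    rw [← hα, h, inv_zero, dot_smul_right, zero_mul]
  have hux : x0 = l2norm x0 • (l2norm x0)⁻¹ • x0 := by rw [smul_inv_smul₀ hr.ne']
  have hu : l2norm ((l2norm x0)⁻¹ • x0) = 1 := by
    rw [l2norm_smul, abs_of_pos (inv_pos.2 hr), inv_mul_cancel₀ hr.ne']
  have hα1 : α ≤ 1 := by
    have := (le_abs_self _).trans (abs_dot_le φ ((l2norm x0)⁻¹ • x0))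
    rwa [hφ, hu, hα, one_mul] at this
  have hk : 0 < k := by
    by_contra! h
    have hx0 : x0 = 0 := by
      rw [← Function.support_eq_empty_iff]
      exact (Set.ncard_eq_zero (Set.toFinite _)).1 (by omega)
    simp [hx0, l2norm] at hr
  have hk0 : (0 : ℝ) < k := by exact_mod_cast hk
  have hk1 : (1 : ℝ) ≤ k := by exact_mod_cast hk
  have hs : 0 < √(k : ℝ) := Real.sqrt_pos.2 hk0
  rw [div_lt_iff₀ hs] at hl1
  rw [lt_div_iff₀ hs] at hl2
  obtain ⟨-, hL⟩ := one_le_log_div hk1 (pow_le_one₀ hα0.le hα1) hkn n.cast_nonneg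
  have hm' : 819200 * C * (k * Real.log ((n : ℝ) / k)) ≤ α ^ 7 * m := by
    have h := mul_le_mul_of_nonneg_left hm.le (pow_pos hα0 7).le
    refine le_trans (le_of_eq ?_) h
    field_simp
  have hkm : (k : ℝ) ≤ α ^ 7 * m := by
    have h : (k : ℝ) ≤ k * Real.log ((n : ℝ) / k) := le_mul_of_one_le_right hk0.le hL
    rw [hC] at hm'
    linarith
  have hm0 : 0 < m := by
    refine Nat.pos_of_ne_zero fun h => ?_
    rw [h, Nat.cast_zero, mul_zero] at hkm
    linarith
  have hα5 : α ^ 5 ≤ 1 := pow_le_one₀ hα0.le hα1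
  have hα5' : 0 < α ^ 5 := by positivity
  have hCk : 1 ≤ C * k / α ^ 5 := by
    rw [le_div_iff₀ hα5', hC]
    linarith
  obtain ⟨N, hN⟩ : ∃ N : ℕ, N = ⌈C * k / α ^ 5⌉₊ := ⟨_, rfl⟩
  have hNlo : C * k / α ^ 5 ≤ N := hN ▸ Nat.le_ceil _
  have hNhi : (N : ℝ) < C * k / α ^ 5 + 1 := hN ▸ Nat.ceil_lt_add_one (by linarith)
  have hN0 : (0 : ℝ) < N := by linarith
  have hN1 : (k : ℝ) ≤ N := by
    refine le_trans ?_ hNlo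
    rw [le_div_iff₀ hα5', hC]
    nlinarith
  have hN2 : N * α ^ 5 ≤ 2 * C * k := by
    have h : (N : ℝ) ≤ 2 * C * k / α ^ 5 := by
      rw [mul_assoc, mul_div_assoc]
      linarith
    rwa [le_div_iff₀ hα5'] at h
  have hN3 : 36 / (N : ℝ) ≤ α / 51200 * (α ^ 2 / (512 * √k)) ^ 2 := by
    rw [div_le_iff₀ hα5'] at hNlo
    rw [div_pow, mul_pow, Real.sq_sqrt hk0.le, div_mul_div_comm,
      div_le_div_iff₀ hN0 (by positivity)]
    rw [hC] at hNlo
    linarith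
  have hNη : 36 / (N : ℝ) ≤ (α ^ 2 / (512 * √k)) ^ 2 :=
    hN3.trans (mul_le_of_le_one_left (by positivity) (by linarith))
  have hfail := (stdGaussianVectors_real_not_spmUniqueMax_le (lam := lam) hm0 hk
    (by exact_mod_cast hN0) hsupp hφ hu hr hux hα hα0 (by linarith) hl2 hNη).trans
    (union_bound_exponents_le hα0 hα1 hk hkn (by rw [hC]; norm_num) hm' hN1 hN2 hN3)
  have hrate := rpow_rate_le hα0 m.cast_nonneg hk0.le hkm
  have : IsProbabilityMeasure (stdGaussianVectors m n) := by
    unfold stdGaussianVectors; infer_instance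
  have hunion := measureReal_union_le (μ := stdGaussianVectors m n)
    {a | SPMUniqueMax a x0 φ lam} {a | SPMUniqueMax a x0 φ lam}ᶜ
  rw [Set.union_compl_self, probReal_univ] at hunion
  refine ENNReal.ofReal_le_of_le_toReal ?_
  change _ ≤ (stdGaussianVectors m n).real _
  have hmono : Real.exp (-(1 / 102400) * (α * m)) ≤
      Real.exp (-(1 / 102400) * α ^ (-(2 : ℝ) / 5) * (m : ℝ) ^ ((4 : ℝ) / 5) *
        (k : ℝ) ^ ((1 : ℝ) / 5)) := by
    rw [Real.exp_le_exp]
    linarith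
  linarith
end

section
/- Let x0, h, φ ∈ ℝⁿ, let λ > 0, and let Ω = supp(x0) be the support of x0. Write h = h_Ω + h_{Ω^c}, where h_Ω and h_{Ω^c} denote the coordinate restrictions of h to Ω and its complement Ω^c. If ⟨φ, x0 + h⟩ − λ‖x0 + h‖₁ ≥ ⟨φ, x0⟩ − λ‖x0‖₁, then ⟨φ, h⟩ ≥ λ·⟨sign(x0), h_Ω⟩ + λ·‖h_{Ω^c}‖₁, where sign(x0) ∈ ℝⁿ is the coordinatewise sign vector of x0 (equal to 0 on Ω^c). -/
/-- Coordinatewise subgradient inequality for the absolute value. -/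
theorem sign_mul_indicator_add_abs_indicator_le {ι : Type*} (x h : ι → ℝ) (j : ι) :
    Real.sign (x j) * (Function.support x).indicator h j +
      |(Function.support x)ᶜ.indicator h j| ≤ |x j + h j| - |x j| := by
  rcases lt_trichotomy (x j) 0 with hx | hx | hx
  · have hmem : j ∈ Function.support x := hx.ne
    simp only [Set.indicator_of_mem hmem, Set.indicator_of_notMem (Set.notMem_compl_iff.2 hmem),
      Real.sign_of_neg hx, abs_of_neg hx, abs_zero]
    linarith [neg_le_abs (x j + h j)]
  · simp [hx, Set.indicator]
  · have hmem : j ∈ Function.support x := hx.ne'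
    simp only [Set.indicator_of_mem hmem, Set.indicator_of_notMem (Set.notMem_compl_iff.2 hmem),
      Real.sign_of_pos hx, abs_of_pos hx, abs_zero]
    linarith [le_abs_self (x j + h j)]

/-- **Subgradient inequality.** Let `Ω = supp(x0)` and write `h = h_Ω + h_{Ω^c}`. If
`⟨φ, x0 + h⟩ − λ‖x0 + h‖₁ ≥ ⟨φ, x0⟩ − λ‖x0‖₁`, then
`⟨φ, h⟩ ≥ λ·⟨sign(x0), h_Ω⟩ + λ·‖h_{Ω^c}‖₁`, where `sign(x0)` is the coordinatewise sign
vector of `x0` (vanishing off `Ω`). -/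
theorem subgradient_inequality {n : ℕ} (x0 h φ : Fin n → ℝ) (lam : ℝ) (hlam : 0 < lam)
    (hobj : dot φ (x0 + h) - lam * l1norm (x0 + h) ≥ dot φ x0 - lam * l1norm x0) :
    dot φ h ≥
      lam * dot (fun j => Real.sign (x0 j)) ((Function.support x0).indicator h) +
        lam * l1norm ((Function.support x0)ᶜ.indicator h) := by
  have hsub : dot (fun j => Real.sign (x0 j)) ((Function.support x0).indicator h) +
      l1norm ((Function.support x0)ᶜ.indicator h) ≤ l1norm (x0 + h) - l1norm x0 := by
    simp only [dot, l1norm, ← Finset.sum_add_distrib, ← Finset.sum_sub_distrib]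
    exact Finset.sum_le_sum fun j _ => sign_mul_indicator_add_abs_indicator_le x0 h j
  have hdot : dot φ (x0 + h) = dot φ x0 + dot φ h := by
    simp [dot, mul_add, Finset.sum_add_distrib]
  linarith [mul_le_mul_of_nonneg_left hsub hlam.le]
end

section
/- Let x0, h, φ ∈ ℝⁿ with ‖x0‖₂ = ‖φ‖₂ = 1, let α = ⟨φ, x0⟩, let λ > 0, let Ω = supp(x0) with |Ω| ≤ k, and let h_{x0^⊥} = h − ⟨x0, h⟩·x0 be the projection of h onto the orthogonal complement of span{x0}. If ⟨φ, h⟩ ≥ λ·⟨sign(x0), h_Ω⟩ + λ·‖h_{Ω^c}‖₁, then ‖h_{Ω^c}‖₁ ≤ √k·‖h_Ω‖₂ + (α/λ)·⟨x0, h_Ω⟩ + (1/λ)·‖h_{x0^⊥}‖₂. -/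
/-- The Cauchy–Schwarz inequality. -/
theorem dot_le_l2norm_mul_l2norm {n : ℕ} (x y : Fin n → ℝ) :
    dot x y ≤ l2norm x * l2norm y :=
  Real.sum_mul_le_sqrt_mul_sqrt _ _ _

theorem dot_indicator_support {n : ℕ} (x h : Fin n → ℝ) :
    dot x ((Function.support x).indicator h) = dot x h := by
  refine Finset.sum_congr rfl fun j _ => ?_
  by_cases hj : x j = 0 <;> simp [Set.indicator, hj]

theorem dot_sub_smul {n : ℕ} (φ h x : Fin n → ℝ) (c : ℝ) :
    dot φ (h - c • x) = dot φ h - c * dot φ x := by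
  simp only [dot, Finset.mul_sum, ← Finset.sum_sub_distrib]
  refine Finset.sum_congr rfl fun j _ => ?_
  simp only [Pi.sub_apply, Pi.smul_apply, smul_eq_mul]
  ring

theorem l2norm_neg_sign {n : ℕ} (x : Fin n → ℝ) :
    l2norm (fun j => -Real.sign (x j)) = Real.sqrt (Function.support x).ncard := by
  classical
  have hsq : ∀ j, (-Real.sign (x j)) ^ 2 = if x j ≠ 0 then 1 else 0 := by
    intro j
    rcases lt_trichotomy (x j) 0 with hj | hj | hj
    · simp [Real.sign_of_neg hj, hj.ne]
    · simp [hj]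
    · simp [Real.sign_of_pos hj, hj.ne']
  have hcard : (Function.support x).ncard = (Finset.univ.filter fun j => x j ≠ 0).card := by
    rw [← Set.ncard_coe_finset]
    congr 1
    ext j
    simp
  simp only [l2norm, hsq, hcard, Finset.sum_boole]

theorem neg_dot_sign_le {n k : ℕ} (x y : Fin n → ℝ) (hk : (Function.support x).ncard ≤ k) :
    -dot (fun j => Real.sign (x j)) y ≤ Real.sqrt k * l2norm y := by
  have hcs := dot_le_l2norm_mul_l2norm (fun j => -Real.sign (x j)) y
  rw [l2norm_neg_sign] at hcs
  have hneg : dot (fun j => -Real.sign (x j)) y = -dot (fun j => Real.sign (x j)) y := by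
    simp [dot]
  rw [← hneg]
  refine hcs.trans (mul_le_mul_of_nonneg_right ?_ (Real.sqrt_nonneg _))
  exact Real.sqrt_le_sqrt (by exact_mod_cast hk)

/-- **Bound on `‖h_{Ω^c}‖₁` (inequality (4) of the paper).** With `‖x0‖₂ = ‖φ‖₂ = 1`,
`α = ⟨φ, x0⟩`, `Ω = supp(x0)`, `|Ω| ≤ k`, and `h_{x0^⊥} = h − ⟨x0, h⟩·x0`, the subgradient
inequality `⟨φ, h⟩ ≥ λ·⟨sign(x0), h_Ω⟩ + λ·‖h_{Ω^c}‖₁` implies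
`‖h_{Ω^c}‖₁ ≤ √k·‖h_Ω‖₂ + (α/λ)·⟨x0, h_Ω⟩ + (1/λ)·‖h_{x0^⊥}‖₂`. -/
theorem homegac_l1_bound {n k : ℕ} (x0 h φ : Fin n → ℝ) (lam α : ℝ)
    (hx0 : l2norm x0 = 1) (hφ : l2norm φ = 1) (hα : α = dot φ x0) (hlam : 0 < lam)
    (hk : (Function.support x0).ncard ≤ k)
    (hsub : dot φ h ≥
      lam * dot (fun j => Real.sign (x0 j)) ((Function.support x0).indicator h) +
        lam * l1norm ((Function.support x0)ᶜ.indicator h)) :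
    l1norm ((Function.support x0)ᶜ.indicator h) ≤
      Real.sqrt k * l2norm ((Function.support x0).indicator h) +
        (α / lam) * dot x0 ((Function.support x0).indicator h) +
        (1 / lam) * l2norm (h - dot x0 h • x0) := by
  have hsign := neg_dot_sign_le x0 ((Function.support x0).indicator h) hk
  have hcs := dot_le_l2norm_mul_l2norm φ (h - dot x0 h • x0)
  rw [dot_sub_smul, hφ, one_mul, ← hα] at hcs
  rw [dot_indicator_support]
  have hscaled := mul_le_mul_of_nonneg_left hsign hlam.le
  refine le_of_mul_le_mul_left ?_ hlam
  have hexpand : lam * (Real.sqrt k * l2norm ((Function.support x0).indicator h) +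
        (α / lam) * dot x0 h + (1 / lam) * l2norm (h - dot x0 h • x0)) =
      lam * (Real.sqrt k * l2norm ((Function.support x0).indicator h)) +
        α * dot x0 h + l2norm (h - dot x0 h • x0) := by
    field_simp
  rw [hexpand]
  linarith
end
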